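/- arXiv:1102.3904 — 3 statements merged into one kernel-verified Lean document; each statement's English description precedes it below -/
import Mathlib

section
/- Let k*, k** ∈ ℕ and let ε be a real with 0 < ε < 1/2^{k**}. Then there exist m, N ∈ ℕ with m ≤ (3+ε)·(8/ε)^{k**} such that: for every finite graph G having the non-k*-order property and the non-k**-tree property, and every A ⊆ G with |A| ≥ N, there is a partition ⟨A_i : i < i(*)⟩ of A with i(*) ≤ m such that (1) ||A_i| − |A_j|| ≤ 1 for all i, j < i(*); (2) each A_i is ε-excellent; and (3) for all i ≠ j < i(*), the pair (A_i, A_j) is (ε,ε)-uniform. -/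
open Finset

open scoped Classical

namespace Paper

variable {V : Type}

/-- `G` has the `k`-order property. -/
def HasOrderProp (G : SimpleGraph V) (k : ℕ) : Prop :=
  ∃ a b : Fin k → V, ∀ i j : Fin k, i < j → G.Adj (a i) (b j) ∧ ¬ G.Adj (a j) (b i)

/-- `G` has the non-`k`-order property. -/
def NoOrderProp (G : SimpleGraph V) (k : ℕ) : Prop := ¬ HasOrderProp G k

/-- `G` has the non-`k`-tree property. -/
def NoTreeProp (G : SimpleGraph V) (k : ℕ) : Prop :=
  ¬ ∃ (a : (Fin k → Bool) → V) (b : (m : Fin k) → (Fin (m : ℕ) → Bool) → V),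
      ∀ (η : Fin k → Bool) (m : Fin k) (ρ : Fin (m : ℕ) → Bool),
        (∀ i : Fin (m : ℕ), η ⟨i.1, i.2.trans m.2⟩ = ρ i) →
        (G.Adj (a η) (b m ρ) ↔ η m = true)

/-- The truth value `t` is the `ζ`-average of the vertex `a` over the set `B`:
all but fewer than `ζ|B|` of the `b ∈ B` satisfy `(a R b) ≡ t`. -/
def AvgIs (G : SimpleGraph V) (ζ : ℝ) (B : Finset V) (a : V) (t : Bool) : Prop :=
  ((B.filter fun b => ¬ (G.Adj a b ↔ t = true)).card : ℝ) < ζ * B.card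

/-- `A` is `ε`-good. -/
def Good (G : SimpleGraph V) (ε : ℝ) (A : Finset V) : Prop :=
  ∀ b : V, ∃ t : Bool, AvgIs G ε A b t

/-- `A` is `(ε,ζ)`-excellent. -/
def Excellent (G : SimpleGraph V) (ε ζ : ℝ) (A : Finset V) : Prop :=
  Good G ε A ∧
    ∀ B : Finset V, Good G ζ B →
      ∃ t : Bool, ((A.filter fun a => ¬ AvgIs G ζ B a t).card : ℝ) < ε * A.card

/-- The pair `(A,B)` is `(ε,ζ)`-uniform. -/
def Uniform (G : SimpleGraph V) (ε ζ : ℝ) (A B : Finset V) : Prop :=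
  ∃ t : Bool, ((A.filter fun a => ¬ AvgIs G ζ B a t).card : ℝ) < ε * A.card

/-- `A` is `f`-indivisible. -/
def Indivisible (G : SimpleGraph V) (f : ℕ → ℕ) (A : Finset V) : Prop :=
  ∀ b : V, ∃ t : Bool, (A.filter fun a => ¬ (G.Adj a b ↔ t = true)).card < f A.card

/-- `A` is `ε`-indivisible, for a real `ε ∈ (0,1)`. -/
def EpsIndivisible (G : SimpleGraph V) (ε : ℝ) (A : Finset V) : Prop :=
  ∀ b : V, ∃ t : Bool,
    ((A.filter fun a => ¬ (G.Adj a b ↔ t = true)).card : ℝ) < (A.card : ℝ) ^ ε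

/-- The edge density between `A` and `B`. -/
noncomputable def density (G : SimpleGraph V) (A B : Finset V) : ℝ :=
  (((A ×ˢ B).filter fun p => G.Adj p.1 p.2).card : ℝ) / (A.card * B.card)

/-- The pair `(A,B)` is `ε`-regular. -/
def Regular (G : SimpleGraph V) (ε : ℝ) (A B : Finset V) : Prop :=
  ∀ A' ⊆ A, ∀ B' ⊆ B, ε * A.card ≤ (A'.card : ℝ) → ε * B.card ≤ (B'.card : ℝ) →
    |density G A B - density G A' B'| < ε

/-- The sequence `⟨a_i : i < n⟩` is `Δ_k`-indiscernible. -/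
def DeltaIndiscernible (G : SimpleGraph V) (k : ℕ) {n : ℕ} (a : Fin n → V) : Prop :=
  Function.Injective a ∧
  (∀ i₀ i₁ j₀ j₁ : Fin n, i₀ < i₁ → j₀ < j₁ →
    (G.Adj (a i₀) (a i₁) ↔ G.Adj (a j₀) (a j₁))) ∧
  (∀ m : ℕ, m ≤ k → ∀ i j : Fin k → Fin n, StrictMono i → StrictMono j →
    (((∃ y : V, (∀ ℓ : Fin k, (ℓ : ℕ) < m → G.Adj y (a (i ℓ))) ∧
                (∀ ℓ : Fin k, m ≤ (ℓ : ℕ) → ¬ G.Adj y (a (i ℓ)))) ↔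
      (∃ y : V, (∀ ℓ : Fin k, (ℓ : ℕ) < m → G.Adj y (a (j ℓ))) ∧
                (∀ ℓ : Fin k, m ≤ (ℓ : ℕ) → ¬ G.Adj y (a (j ℓ))))) ∧
     ((∃ y : V, (∀ ℓ : Fin k, (ℓ : ℕ) < m → ¬ G.Adj y (a (i ℓ))) ∧
                (∀ ℓ : Fin k, m ≤ (ℓ : ℕ) → G.Adj y (a (i ℓ)))) ↔
      (∃ y : V, (∀ ℓ : Fin k, (ℓ : ℕ) < m → ¬ G.Adj y (a (j ℓ))) ∧
                (∀ ℓ : Fin k, m ≤ (ℓ : ℕ) → G.Adj y (a (j ℓ)))))))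

section Tree

variable {V : Type} {G : SimpleGraph V} {ζ : ℝ}

lemma exists_mem_forall_adj_iff {ι : Type*} [Fintype ι] {B : Finset V} (hB : B.Nonempty)
    (hζ : Fintype.card ι * ζ ≤ 1) (x : ι → V) (t : ι → Bool)
    (h : ∀ i, AvgIs G ζ B (x i) (t i)) :
    ∃ b ∈ B, ∀ i, G.Adj (x i) b ↔ t i = true := by
  by_contra hcon
  have hsub : B ⊆ univ.biUnion fun i => B.filter fun b => ¬ (G.Adj (x i) b ↔ t i = true) := by
    intro b hb
    by_contra hb'
    refine hcon ⟨b, hb, fun i => ?_⟩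
    by_contra hi
    exact hb' (mem_biUnion.2 ⟨i, mem_univ i, mem_filter.2 ⟨hb, hi⟩⟩)
  have hle : (B.card : ℝ) ≤
      ∑ i, ((B.filter fun b => ¬ (G.Adj (x i) b ↔ t i = true)).card : ℝ) := by
    exact_mod_cast (card_le_card hsub).trans card_biUnion_le
  have hpos : (0 : ℝ) < B.card := by exact_mod_cast hB.card_pos
  rcases isEmpty_or_nonempty ι with hι | hι
  · simp only [univ_eq_empty, sum_empty] at hle
    linarith
  · have hlt := sum_lt_sum_of_nonempty univ_nonempty fun i (_ : i ∈ univ) => h i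
    simp only [sum_const, card_univ, nsmul_eq_mul] at hlt
    nlinarith

lemma Good.nonempty [Nonempty V] {B : Finset V} (hB : Good G ζ B) : B.Nonempty := by
  obtain ⟨t, ht⟩ := hB (Classical.arbitrary V)
  by_contra hne
  simp [AvgIs, not_nonempty_iff_eq_empty.1 hne] at ht

lemma Good.avgIs_of_not_avgIs {B : Finset V} (hB : Good G ζ B) {a : V} {t : Bool}
    (h : ¬ AvgIs G ζ B a (!t)) : AvgIs G ζ B a t := by
  obtain ⟨s, hs⟩ := hB a
  by_cases hst : s = t
  · exact hst ▸ hs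
  · exact absurd (Bool.eq_not_of_ne hst ▸ hs) h

lemma avgIs_singleton (hζ0 : 0 < ζ) (hζ1 : ζ ≤ 1) {a b : V} {t : Bool} :
    AvgIs G ζ {b} a t ↔ (G.Adj a b ↔ t = true) := by
  by_cases h : G.Adj a b ↔ t = true
  · simp [AvgIs, filter_singleton, h, hζ0]
  · simp [AvgIs, filter_singleton, h, hζ1]

lemma good_singleton (hζ0 : 0 < ζ) (hζ1 : ζ ≤ 1) (b : V) : Good G ζ {b} := fun a =>
  ⟨decide (G.Adj a b), (avgIs_singleton hζ0 hζ1).2 (by simp)⟩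

lemma excellent_of_forall_uniform {ε : ℝ} (hζ0 : 0 < ζ) (hζ1 : ζ ≤ 1) {A : Finset V}
    (h : ∀ B, Good G ζ B → Uniform G ε ζ A B) : Excellent G ε ζ A := by
  refine ⟨fun b => ?_, h⟩
  obtain ⟨t, ht⟩ := h {b} (good_singleton hζ0 hζ1 b)
  refine ⟨t, ?_⟩
  simp only [avgIs_singleton hζ0 hζ1, G.adj_comm _ b] at ht
  exact ht

lemma exists_large_subset_forall_uniform {K : ℕ} {δ : ℝ} (hδ0 : 0 < δ) (hδ1 : δ ≤ 1)
    (hζ0 : 0 < ζ) (hζ : 2 ^ (K + 1) * ζ ≤ 1) (hG : NoTreeProp G (K + 1)) {A : Finset V}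
    (hA : A.Nonempty) :
    ∃ A' ⊆ A, δ ^ K * A.card ≤ A'.card ∧ ∀ B, Good G ζ B → Uniform G δ ζ A' B := by
  by_contra hcon
  have : Nonempty V := ⟨hA.choose⟩
  have hex : ∀ Y : Finset V, ∃ B : Finset V, Good G ζ B ∧
      (Y ⊆ A → δ ^ K * A.card ≤ Y.card →
        ∀ t, δ * Y.card ≤ ((Y.filter fun a => ¬ AvgIs G ζ B a t).card : ℝ)) := by
    intro Y
    by_cases hY : Y ⊆ A ∧ δ ^ K * A.card ≤ Y.card
    · by_contra hB
      refine hcon ⟨Y, hY.1, hY.2, fun B hgood => ?_⟩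
      by_contra hu
      exact hB ⟨B, hgood, fun _ _ t => not_lt.1 fun hlt => hu ⟨t, hlt⟩⟩
    · exact ⟨{hA.choose}, good_singleton hζ0
        (by nlinarith [one_le_pow₀ (M₀ := ℝ) one_le_two (n := K + 1)]) _,
        fun h1 h2 => absurd ⟨h1, h2⟩ hY⟩
  choose B hgood hB using hex
  let X : (ℕ → Bool) → ℕ → Finset V := fun η m =>
    Nat.rec A (fun m Y => Y.filter fun a => ¬ AvgIs G ζ (B Y) a (!(η m))) m
  have hXs : ∀ η m, X η (m + 1) =
      (X η m).filter fun a => ¬ AvgIs G ζ (B (X η m)) a (!(η m)) := fun _ _ => rfl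
  have hanti : ∀ η, Antitone (X η) := fun η => antitone_nat_of_succ_le fun m => by
    rw [hXs]; exact filter_subset _ _
  have hsub : ∀ η m, X η m ⊆ A := fun η m => hanti η (Nat.zero_le m)
  have hcongr : ∀ η η' m, (∀ i < m, η i = η' i) → X η m = X η' m := by
    intro η η' m
    induction m with
    | zero => intro _; rfl
    | succ m ih =>
      intro h
      rw [hXs, hXs, ih fun i hi => h i (hi.trans m.lt_succ_self), h m m.lt_succ_self]
  have hcard : ∀ η m, m ≤ K + 1 → δ ^ m * A.card ≤ (X η m).card := by
    intro η m
    induction m with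
    | zero => intro _; simp [X]
    | succ m ih =>
      intro hm
      have h1 := ih (by omega)
      have h2 : δ ^ K * (A.card : ℝ) ≤ (X η m).card := by
        refine le_trans ?_ h1
        exact mul_le_mul_of_nonneg_right (pow_le_pow_of_le_one hδ0.le hδ1 (by omega))
          (Nat.cast_nonneg _)
      have h3 := hB _ (hsub η m) h2 (!(η m))
      rw [← hXs] at h3
      rw [pow_succ']
      nlinarith
  have hne : ∀ η, (X η (K + 1)).Nonempty := by
    intro η
    have hpos : (0 : ℝ) < A.card := by exact_mod_cast hA.card_pos
    have h1 := hcard η (K + 1) le_rfl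
    have h2 : (0 : ℝ) < (X η (K + 1)).card := lt_of_lt_of_le (by positivity) h1
    exact card_pos.1 (by exact_mod_cast h2)
  let ext : {m : ℕ} → (Fin m → Bool) → ℕ → Bool := fun {m} ρ i =>
    if h : i < m then ρ ⟨i, h⟩ else false
  let a : (Fin (K + 1) → Bool) → V := fun η => (hne (ext η)).choose
  have ha : ∀ η, a η ∈ X (ext η) (K + 1) := fun η => (hne (ext η)).choose_spec
  have hb : ∀ (m : Fin (K + 1)) (ρ : Fin (m : ℕ) → Bool), ∃ b : V,
      ∀ η : Fin (K + 1) → Bool, (∀ i : Fin (m : ℕ), η ⟨i.1, i.2.trans m.2⟩ = ρ i) →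
        (G.Adj (a η) b ↔ η m = true) := by
    intro m ρ
    let ι := {η : Fin (K + 1) → Bool // ∀ i : Fin (m : ℕ), η ⟨i.1, i.2.trans m.2⟩ = ρ i}
    have hι : (Fintype.card ι : ℝ) ≤ 2 ^ (K + 1) := by
      have := Fintype.card_subtype_le
        fun η : Fin (K + 1) → Bool => ∀ i : Fin (m : ℕ), η ⟨i.1, i.2.trans m.2⟩ = ρ i
      simp only [Fintype.card_fun, Fintype.card_bool, Fintype.card_fin] at this
      exact_mod_cast this
    obtain ⟨b, -, hb⟩ := exists_mem_forall_adj_iff (G := G) (ζ := ζ) (ι := ι)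
      (hgood (X (ext ρ) m)).nonempty (by nlinarith) (fun η => a η.1) (fun η => η.1 m) (by
        rintro ⟨η, hη⟩
        have hXeq : X (ext ρ) m = X (ext η) m := by
          refine hcongr _ _ _ fun i hi => ?_
          simp [ext, hi, hi.trans m.2, ← hη ⟨i, hi⟩]
        have hmem := hanti (ext η) (Nat.succ_le_of_lt m.2) (ha η)
        rw [Nat.succ_eq_add_one, hXs, mem_filter, ← hXeq] at hmem
        refine (hgood _).avgIs_of_not_avgIs ?_
        have hext : ext η m = η m := dif_pos m.2
        rw [hext] at hmem
        exact hmem.2)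
    exact ⟨b, fun η hη => hb ⟨η, hη⟩⟩
  choose b hb using hb
  exact hG ⟨a, b, fun η m ρ h => hb m ρ η h⟩

lemma card_lt_of_shatters {K : ℕ} (hG : NoTreeProp G (K + 1)) (hζ : ((K + 1 : ℕ) : ℝ) * ζ ≤ 1)
    {A : Finset V} {t : Bool} {𝒜 : Finset (Finset V)}
    (h𝒜 : ∀ S ∈ 𝒜, ∃ B, Good G ζ B ∧ S = A.filter fun a => ¬ AvgIs G ζ B a t)
    {T : Finset V} (hT : 𝒜.Shatters T) : T.card < K + 1 := by
  by_contra! hcard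
  obtain ⟨T', hT'T, hT'⟩ := exists_subset_card_eq hcard
  replace hT := hT.mono_right hT'T
  let e := (T'.equivFinOfCardEq hT').symm
  have : Nonempty V := ⟨e 0⟩
  have hsub : T' ⊆ A := by
    obtain ⟨S, hS, hTS⟩ := hT.exists_superset
    obtain ⟨B, -, rfl⟩ := h𝒜 S hS
    exact hTS.trans (filter_subset _ _)
  have key : ∀ η : Fin (K + 1) → Bool, ∃ b, ∀ i, G.Adj (e i : V) b ↔ η i = true := by
    intro η
    let U : Finset V := (univ.filter fun i => η i ≠ t).image fun i => (e i : V)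
    have hU : U ⊆ T' := by
      intro x hx
      obtain ⟨i, -, rfl⟩ := mem_image.1 hx
      exact (e i).2
    have hmem : ∀ i, (e i : V) ∈ U ↔ η i ≠ t := by
      intro i
      simp only [U, mem_image, mem_filter, mem_univ, true_and]
      constructor
      · rintro ⟨j, hj, hji⟩
        rwa [← e.injective (Subtype.ext hji)]
      · exact fun h => ⟨i, h, rfl⟩
    obtain ⟨S, hS, hST⟩ := hT hU
    obtain ⟨B, hB, rfl⟩ := h𝒜 S hS
    have hiff : ∀ i, ¬ AvgIs G ζ B (e i) t ↔ η i ≠ t := by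
      intro i
      rw [← hmem, ← hST]
      simp [hsub (e i).2]
    obtain ⟨b, -, hb⟩ := exists_mem_forall_adj_iff hB.nonempty (by simpa using hζ)
      (fun i => (e i : V)) η fun i => by
        by_cases hi : η i = t
        · rw [hi]
          by_contra h
          exact (hiff i).1 h hi
        · refine hB.avgIs_of_not_avgIs ?_
          rw [← Bool.eq_not_of_ne (Ne.symm hi)]
          exact (hiff i).2 hi
    exact ⟨b, hb⟩
  choose b hb using key
  exact hG ⟨b, fun m _ => e m, fun η m _ _ => by rw [G.adj_comm]; exact hb η m⟩

lemma card_le_of_shatters_card_lt {K : ℕ} {A : Finset V} {𝒜 : Finset (Finset V)}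
    (hA : ∀ S ∈ 𝒜, S ⊆ A) (h : ∀ T, 𝒜.Shatters T → T.card < K + 1) :
    𝒜.card ≤ (K + 1) * (A.card + 1) ^ K := by
  have hsub : 𝒜.shatterer ⊆ (range (K + 1)).biUnion fun i => A.powersetCard i := by
    intro T hT
    rw [mem_shatterer] at hT
    obtain ⟨S, hS, hTS⟩ := hT.exists_superset
    exact mem_biUnion.2 ⟨T.card, mem_range.2 (h T hT),
      mem_powersetCard.2 ⟨hTS.trans (hA S hS), rfl⟩⟩
  calc 𝒜.card ≤ 𝒜.shatterer.card := card_le_card_shatterer 𝒜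
    _ ≤ _ := card_le_card hsub
    _ ≤ ∑ i ∈ range (K + 1), (A.powersetCard i).card := card_biUnion_le
    _ ≤ ∑ i ∈ range (K + 1), (A.card + 1) ^ K := by
      refine sum_le_sum fun i hi => ?_
      rw [card_powersetCard]
      calc A.card.choose i ≤ A.card ^ i := Nat.choose_le_pow _ _
        _ ≤ (A.card + 1) ^ i := Nat.pow_le_pow_left (Nat.le_succ _) _
        _ ≤ (A.card + 1) ^ K :=
          Nat.pow_le_pow_right (Nat.succ_pos _) (Nat.lt_succ_iff.1 (mem_range.1 hi))
    _ = _ := by simp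

end Tree

section Sampling

lemma descFactorial_mul_pow_le {t s : ℕ} (h : t ≤ s) (r : ℕ) :
    t.descFactorial r * s ^ r ≤ t ^ r * s.descFactorial r := by
  induction r with
  | zero => simp
  | succ r ih =>
    rw [Nat.descFactorial_succ, Nat.descFactorial_succ, pow_succ, pow_succ]
    have h1 : (t - r) * s ≤ t * (s - r) := by
      rw [Nat.sub_mul, Nat.mul_sub]
      have := Nat.mul_le_mul_left r h
      rw [Nat.mul_comm t r]
      omega
    calc (t - r) * t.descFactorial r * (s ^ r * s)
        = (t.descFactorial r * s ^ r) * ((t - r) * s) := by ring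
      _ ≤ (t ^ r * s.descFactorial r) * (t * (s - r)) := Nat.mul_le_mul ih h1
      _ = _ := by ring

lemma choose_mul_choose_le {t s c u r : ℕ} {β : ℝ} (hts : t ≤ s) (hs : 0 < s)
    (htβ : (t : ℝ) ≤ β * s) (hu : 2 * β * c ≤ u) (hr : (r : ℝ) ≤ β * c / 2) :
    (t.choose r * c.choose r : ℝ) ≤ (2 / 3) ^ r * (s.choose r * u.choose r) := by
  have hs' : (0 : ℝ) < s := by exact_mod_cast hs
  have hβ : 0 ≤ β := by
    by_contra! hneg
    have : (0 : ℝ) ≤ t := t.cast_nonneg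
    nlinarith
  have hc0 : (0 : ℝ) ≤ c := c.cast_nonneg
  have hβc : 0 ≤ β * c := mul_nonneg hβ hc0
  have hru : r ≤ u := by
    have : (r : ℝ) ≤ u := by linarith
    exact_mod_cast this
  have ht : (t.descFactorial r : ℝ) ≤ β ^ r * s.descFactorial r := by
    have h1 : (t.descFactorial r * s ^ r : ℝ) ≤ t ^ r * s.descFactorial r := by
      exact_mod_cast descFactorial_mul_pow_le hts r
    have h2 : (t : ℝ) ^ r ≤ (β * s) ^ r := pow_le_pow_left₀ t.cast_nonneg htβ r
    rw [mul_pow] at h2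
    refine le_of_mul_le_mul_right ?_ (pow_pos hs' r)
    calc (t.descFactorial r * s ^ r : ℝ) ≤ t ^ r * s.descFactorial r := h1
      _ ≤ (β ^ r * s ^ r) * s.descFactorial r := by gcongr
      _ = _ := by ring
  have hc : (c.descFactorial r : ℝ) ≤ c ^ r := by exact_mod_cast Nat.descFactorial_le_pow c r
  have hud : (3 / 2 * (β * c)) ^ r ≤ (u.descFactorial r : ℝ) := by
    calc (3 / 2 * (β * c)) ^ r ≤ ((u + 1 - r : ℕ) : ℝ) ^ r := by
          refine pow_le_pow_left₀ (by positivity) ?_ r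
          rw [Nat.cast_sub (by omega)]
          push_cast
          linarith
      _ ≤ _ := by exact_mod_cast Nat.pow_sub_le_descFactorial u r
  have hd : (t.descFactorial r * c.descFactorial r : ℝ) ≤
      (2 / 3) ^ r * (s.descFactorial r * u.descFactorial r) := by
    calc (t.descFactorial r * c.descFactorial r : ℝ)
        ≤ (β ^ r * s.descFactorial r) * c ^ r := by gcongr
      _ = (2 / 3) ^ r * (s.descFactorial r * (3 / 2 * (β * c)) ^ r) := by
          have : β ^ r * (c : ℝ) ^ r = (2 / 3) ^ r * (3 / 2 * (β * c)) ^ r := by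
            rw [← mul_pow, ← mul_pow]
            congr 1
            ring
          linear_combination (s.descFactorial r : ℝ) * this
      _ ≤ _ := by gcongr
  simp only [Nat.descFactorial_eq_factorial_mul_choose, Nat.cast_mul] at hd
  have hf : (0 : ℝ) < r.factorial * r.factorial := by positivity
  refine le_of_mul_le_mul_left ?_ hf
  linarith

variable {V : Type}

lemma card_filter_le_card_inter_mul_choose_le {S T : Finset V} {c r u : ℕ} (hTS : T ⊆ S)
    (hrc : r ≤ c) :
    ((S.powersetCard c).filter fun C => u ≤ (C ∩ T).card).card * u.choose r * S.card.choose r ≤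
      T.card.choose r * S.card.choose c * c.choose r := by
  have h1 : ((S.powersetCard c).filter fun C => u ≤ (C ∩ T).card).card * u.choose r ≤
      T.card.choose r * (S.card - r).choose (c - r) := by
    calc ((S.powersetCard c).filter fun C => u ≤ (C ∩ T).card).card * u.choose r
        = ∑ C ∈ (S.powersetCard c).filter (fun C => u ≤ (C ∩ T).card), u.choose r := by simp
      _ ≤ ∑ C ∈ (S.powersetCard c).filter (fun C => u ≤ (C ∩ T).card),
            ((T.powersetCard r).filter fun D => D ⊆ C).card := by
          refine sum_le_sum fun C hC => ?_
          calc u.choose r ≤ (C ∩ T).card.choose r := Nat.choose_le_choose r (mem_filter.1 hC).2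
            _ = ((C ∩ T).powersetCard r).card := (card_powersetCard _ _).symm
            _ ≤ _ := card_le_card fun D hD => by
              rw [mem_powersetCard] at hD
              exact mem_filter.2 ⟨mem_powersetCard.2 ⟨hD.1.trans inter_subset_right, hD.2⟩,
                hD.1.trans inter_subset_left⟩
      _ ≤ ∑ C ∈ S.powersetCard c, ((T.powersetCard r).filter fun D => D ⊆ C).card :=
          sum_le_sum_of_subset (filter_subset _ _)
      _ = ∑ D ∈ T.powersetCard r, ((S.powersetCard c).filter fun C => D ⊆ C).card := by
          simp_rw [card_filter]
          exact sum_comm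
      _ = ∑ D ∈ T.powersetCard r, (S.card - r).choose (c - r) := by
          refine sum_congr rfl fun D hD => ?_
          obtain ⟨hDT, rfl⟩ := mem_powersetCard.1 hD
          exact card_filter_powersetCard_subset D S c (hDT.trans hTS) hrc
      _ = _ := by simp
  calc _ ≤ T.card.choose r * (S.card - r).choose (c - r) * S.card.choose r :=
        Nat.mul_le_mul_right _ h1
    _ = T.card.choose r * (S.card.choose r * (S.card - r).choose (c - r)) := by ring
    _ = _ := by rw [← Nat.choose_mul hrc]; ring

lemma exists_subset_card_eq_forall_card_inter_lt {S : Finset V} {c r : ℕ} {β : ℝ}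
    {F : Finset (Finset V)} (hF : ∀ T ∈ F, T ⊆ S ∧ (T.card : ℝ) ≤ β * S.card) (hβ : β ≤ 1)
    (hc : 0 < c) (hcS : c ≤ S.card) (hr : (r : ℝ) ≤ β * c / 2) (hFr : F.card * (2 / 3 : ℝ) ^ r < 1) :
    ∃ C ⊆ S, C.card = c ∧ ∀ T ∈ F, ((C ∩ T).card : ℝ) < 2 * β * c := by
  by_contra hcon
  set u := ⌈2 * β * c⌉₊ with hu
  have hc' : (0 : ℝ) < c := by exact_mod_cast hc
  have hrc : r ≤ c := by
    have : (r : ℝ) ≤ c := by nlinarith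
    exact_mod_cast this
  have hule : 2 * β * c ≤ u := Nat.le_ceil _
  have hru : r ≤ u := by
    have h0 : (0 : ℝ) ≤ r := r.cast_nonneg
    have : (r : ℝ) ≤ u := by nlinarith
    exact_mod_cast this
  have hsub : S.powersetCard c ⊆
      F.biUnion fun T => (S.powersetCard c).filter fun C => u ≤ (C ∩ T).card := by
    intro C hC
    by_contra hC'
    obtain ⟨hCS, hCc⟩ := mem_powersetCard.1 hC
    refine hcon ⟨C, hCS, hCc, fun T hT => ?_⟩
    by_contra! hle
    exact hC' (mem_biUnion.2 ⟨T, hT, mem_filter.2 ⟨hC, Nat.ceil_le.2 hle⟩⟩)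
  have hbad : ∀ T ∈ F,
      (((S.powersetCard c).filter fun C => u ≤ (C ∩ T).card).card : ℝ) ≤
        (2 / 3) ^ r * S.card.choose c := by
    intro T hT
    obtain ⟨hTS, hTβ⟩ := hF T hT
    have h1 : (((S.powersetCard c).filter fun C => u ≤ (C ∩ T).card).card * u.choose r *
        S.card.choose r : ℝ) ≤ T.card.choose r * S.card.choose c * c.choose r := by
      exact_mod_cast card_filter_le_card_inter_mul_choose_le (u := u) hTS hrc
    have h2 := choose_mul_choose_le (u := u) (r := r) (card_le_card hTS) (hc.trans_le hcS) hTβ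
      hule hr
    have h3 : (0 : ℝ) < u.choose r * S.card.choose r := by
      have := Nat.choose_pos hru
      have := Nat.choose_pos (hrc.trans hcS)
      positivity
    refine le_of_mul_le_mul_right ?_ h3
    have h4 := mul_le_mul_of_nonneg_left h2 (S.card.choose c).cast_nonneg (α := ℝ)
    linarith
  have hle : (S.card.choose c : ℝ) ≤ F.card * ((2 / 3) ^ r * S.card.choose c) := by
    calc (S.card.choose c : ℝ) = (S.powersetCard c).card := by rw [card_powersetCard]
      _ ≤ ∑ T ∈ F, (((S.powersetCard c).filter fun C => u ≤ (C ∩ T).card).card : ℝ) := by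
          exact_mod_cast (card_le_card hsub).trans card_biUnion_le
      _ ≤ ∑ T ∈ F, (2 / 3) ^ r * (S.card.choose c : ℝ) := sum_le_sum hbad
      _ = _ := by simp
  have hpos : (0 : ℝ) < S.card.choose c := by exact_mod_cast Nat.choose_pos hcS
  nlinarith

end Sampling

section Partition

variable {V : Type}

lemma exists_maximal_packing {γ : ℝ} {c : ℕ} (hc : 0 < c) {Q : Finset V → Prop} (A : Finset V)
    (h : ∀ R ⊆ A, c ≤ γ * R.card → ∃ C ⊆ R, C.card = c ∧ Q C) :
    ∃ (p : ℕ) (P : Fin p → Finset V) (R : Finset V), (∀ i, P i ⊆ A) ∧ R ⊆ A ∧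
      (∀ i j, i ≠ j → Disjoint (P i) (P j)) ∧ (∀ i, Disjoint (P i) R) ∧
      (∀ a ∈ A, a ∈ R ∨ ∃ i, a ∈ P i) ∧ (∀ i, (P i).card = c ∧ Q (P i)) ∧
      γ * R.card < c ∧ p * c + R.card = A.card := by
  induction A using Finset.strongInduction with
  | H A ih =>
    by_cases hA : c ≤ γ * A.card
    · obtain ⟨C, hCA, hCc, hQ⟩ := h A Subset.rfl hA
      have hCne : C.Nonempty := card_pos.1 (hCc ▸ hc)
      obtain ⟨p, P, R, hP, hR, hd, hdR, hcov, hPQ, hlt, hcard⟩ :=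
        ih (A \ C) (sdiff_ssubset hCA hCne) fun R hR => h R (hR.trans sdiff_subset)
      have hdisj : ∀ i, Disjoint C (P i) := fun i =>
        (disjoint_sdiff_self_left.mono_left (hP i)).symm
      refine ⟨p + 1, Fin.cons C P, R, ?_, hR.trans sdiff_subset, ?_, ?_, ?_, ?_, hlt, ?_⟩
      · exact Fin.cases hCA fun i => (hP i).trans sdiff_subset
      · intro i j
        induction i using Fin.cases with
        | zero =>
          induction j using Fin.cases with
          | zero => simp
          | succ j => intro _; simpa using hdisj j
        | succ i =>
          induction j using Fin.cases with
          | zero => intro _; simpa using (hdisj i).symm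
          | succ j => intro hij; simpa using hd i j fun h => hij (congrArg Fin.succ h)
      · exact Fin.cases ((disjoint_sdiff_self_left.mono_left hR).symm) hdR
      · intro a ha
        by_cases haC : a ∈ C
        · exact Or.inr ⟨0, haC⟩
        · rcases hcov a (mem_sdiff.2 ⟨ha, haC⟩) with h | ⟨i, hi⟩
          · exact Or.inl h
          · exact Or.inr ⟨i.succ, hi⟩
      · exact Fin.cases ⟨hCc, hQ⟩ hPQ
      · have := card_sdiff_add_card_eq_card hCA
        rw [← this, ← hcard, hCc]
        ring
    · exact ⟨0, Fin.elim0, A, fun i => i.elim0, Subset.rfl, fun i => i.elim0, fun i => i.elim0,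
        fun a ha => Or.inl ha, fun i => i.elim0, not_le.1 hA, by simp⟩

lemma exists_equitable_split (R : Finset V) {p : ℕ} (hp : 0 < p) :
    ∃ E : Fin p → Finset V, (∀ i, E i ⊆ R) ∧ (∀ i j, i ≠ j → Disjoint (E i) (E j)) ∧
      (∀ a ∈ R, ∃ i, a ∈ E i) ∧
      ∀ i, R.card / p ≤ (E i).card ∧ (E i).card ≤ R.card / p + 1 := by
  let e := R.equivFin
  let f : V → ℕ := fun x => if h : x ∈ R then e ⟨x, h⟩ else 0
  have hf : ∀ x (h : x ∈ R), f x = e ⟨x, h⟩ := fun x h => by simp [f, h]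
  refine ⟨fun i => R.filter fun x => f x % p = i, fun i => filter_subset _ _, ?_, ?_, ?_⟩
  · intro i j hij
    refine disjoint_filter.2 fun x _ hi hj => hij (Fin.ext (hi.symm.trans hj))
  · exact fun a ha => ⟨⟨f a % p, Nat.mod_lt _ hp⟩, mem_filter.2 ⟨ha, rfl⟩⟩
  · intro i
    have hcard : (R.filter fun x => f x % p = i).card =
        ((range R.card).filter fun n => n ≡ i [MOD p]).card := by
      refine card_nbij f ?_ ?_ ?_
      · intro x hx
        obtain ⟨hxR, hx⟩ := mem_filter.1 hx
        refine mem_filter.2 ⟨mem_range.2 ?_, ?_⟩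
        · rw [hf x hxR]; exact (e _).2
        · rw [Nat.ModEq, hx, Nat.mod_eq_of_lt i.2]
      · intro x hx y hy hxy
        have hxR := (mem_filter.1 hx).1
        have hyR := (mem_filter.1 hy).1
        rw [hf x hxR, hf y hyR] at hxy
        exact congrArg Subtype.val (e.injective (Fin.ext hxy))
      · intro n hn
        obtain ⟨hnR, hn⟩ := mem_filter.1 hn
        rw [mem_range] at hnR
        have hfn : f (e.symm ⟨n, hnR⟩) = n := by
          rw [hf _ (e.symm ⟨n, hnR⟩).2]
          simp
        refine ⟨e.symm ⟨n, hnR⟩, ?_, hfn⟩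
        refine mem_coe.2 (mem_filter.2 ⟨(e.symm ⟨n, hnR⟩).2, ?_⟩)
        rw [hfn]
        rw [Nat.ModEq, Nat.mod_eq_of_lt i.2] at hn
        exact hn
    have := Nat.count_modEq_card R.card hp i
    rw [Nat.count_eq_card_filter_range] at this
    simp only [hcard]
    rw [this]
    split_ifs <;> omega

end Partition

section Main

variable {V : Type} {G : SimpleGraph V}

lemma exists_uniform_subset_of_card {K c r n : ℕ} {ε : ℝ} (hε0 : 0 < ε)
    (hε1 : 2 ^ (K + 1) * ε ≤ 1) (hG : NoTreeProp G (K + 1)) {R : Finset V} (hRn : R.card ≤ n)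
    (hc : 0 < c) (hcR : c ≤ (ε / 4) ^ K * R.card) (hr : (r : ℝ) ≤ ε / 4 * c / 2)
    (hbig : 2 * ((K + 1) * (n + 1) ^ K) * (2 / 3 : ℝ) ^ r < 1) :
    ∃ C ⊆ R, C.card = c ∧ ∀ B, Good G ε B →
      ∃ t : Bool, ((C.filter fun a => ¬ AvgIs G ε B a t).card : ℝ) < ε / 2 * c := by
  have h2K : (1 : ℝ) ≤ 2 ^ (K + 1) := one_le_pow₀ one_le_two
  have hε : ε ≤ 1 := by nlinarith
  have hKε : ((K + 1 : ℕ) : ℝ) * ε ≤ 1 := by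
    have : ((K + 1 : ℕ) : ℝ) ≤ 2 ^ (K + 1) := by exact_mod_cast Nat.lt_two_pow_self.le
    nlinarith
  have hc' : (0 : ℝ) < c := by exact_mod_cast hc
  have hR : R.Nonempty := by
    rw [nonempty_iff_ne_empty]
    rintro rfl
    simp only [card_empty, Nat.cast_zero, mul_zero] at hcR
    linarith
  obtain ⟨S, hSR, hScard, hSu⟩ := exists_large_subset_forall_uniform (δ := ε / 4)
    (by positivity) (by linarith) hε0 hε1 hG hR
  have hcS : c ≤ S.card := by exact_mod_cast hcR.trans hScard
  let 𝒜 : Bool → Finset (Finset V) := fun t => S.powerset.filter fun T =>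
    ∃ B, Good G ε B ∧ T = S.filter fun a => ¬ AvgIs G ε B a t
  have h𝒜card : ∀ t, (𝒜 t).card ≤ (K + 1) * (n + 1) ^ K := fun t =>
    calc (𝒜 t).card ≤ (K + 1) * (S.card + 1) ^ K :=
          card_le_of_shatters_card_lt (fun T hT => mem_powerset.1 (mem_filter.1 hT).1)
            fun T => card_lt_of_shatters hG hKε fun T hT => (mem_filter.1 hT).2
      _ ≤ _ := by
          have := (card_le_card hSR).trans hRn
          gcongr
  let F := (𝒜 true ∪ 𝒜 false).filter fun T => (T.card : ℝ) ≤ ε / 4 * S.card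
  have hFcard : (F.card : ℝ) ≤ 2 * ((K + 1) * (n + 1) ^ K) := by
    have h1 : F.card ≤ (𝒜 true).card + (𝒜 false).card :=
      (card_filter_le _ _).trans (card_union_le _ _)
    have h2 : F.card ≤ 2 * ((K + 1) * (n + 1) ^ K) := by
      linarith [h𝒜card true, h𝒜card false]
    exact_mod_cast h2
  have hmemF : ∀ B, Good G ε B → ∀ t,
      ((S.filter fun a => ¬ AvgIs G ε B a t).card : ℝ) < ε / 4 * S.card →
        (S.filter fun a => ¬ AvgIs G ε B a t) ∈ F := by
    intro B hB t ht
    have hmem : (S.filter fun a => ¬ AvgIs G ε B a t) ∈ 𝒜 t :=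
      mem_filter.2 ⟨mem_powerset.2 (filter_subset _ _), B, hB, rfl⟩
    refine mem_filter.2 ⟨mem_union.2 ?_, ht.le⟩
    cases t
    · exact Or.inr hmem
    · exact Or.inl hmem
  have hFr : F.card * (2 / 3 : ℝ) ^ r < 1 :=
    (mul_le_mul_of_nonneg_right hFcard (by positivity)).trans_lt hbig
  obtain ⟨C, hCS, hCc, hCF⟩ := exists_subset_card_eq_forall_card_inter_lt (S := S) (F := F)
    (fun T hT => ⟨by
      rcases mem_union.1 (mem_filter.1 hT).1 with h | h <;>
        exact mem_powerset.1 (mem_filter.1 h).1, (mem_filter.1 hT).2⟩)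
    (by linarith : ε / 4 ≤ 1) hc hcS hr hFr
  refine ⟨C, hCS.trans hSR, hCc, fun B hB => ?_⟩
  obtain ⟨t, ht⟩ := hSu B hB
  refine ⟨t, ?_⟩
  have h1 := hCF _ (hmemF B hB t ht)
  rw [inter_filter, inter_eq_left.2 hCS] at h1
  linarith

lemma excellent_union {c : ℕ} {ε : ℝ} (hε0 : 0 < ε) (hε1 : ε ≤ 1) {C E : Finset V}
    (hCE : Disjoint C E) (hCc : C.card = c) (hEc : (E.card : ℝ) ≤ ε / 2 * c)
    (hC : ∀ B, Good G ε B →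
      ∃ t : Bool, ((C.filter fun a => ¬ AvgIs G ε B a t).card : ℝ) < ε / 2 * c) :
    Excellent G ε ε (C ∪ E) := by
  refine excellent_of_forall_uniform hε0 hε1 fun B hB => ?_
  obtain ⟨t, ht⟩ := hC B hB
  refine ⟨t, ?_⟩
  rw [filter_union, card_union_of_disjoint hCE, hCc]
  have h1 : (((C.filter fun a => ¬ AvgIs G ε B a t) ∪
      E.filter fun a => ¬ AvgIs G ε B a t).card : ℝ) ≤
      (C.filter fun a => ¬ AvgIs G ε B a t).card + E.card := by
    exact_mod_cast (card_union_le _ _).trans (Nat.add_le_add_left (card_filter_le _ _) _)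
  push_cast
  have : 0 ≤ ε * E.card := by positivity
  linarith

lemma exists_forall_mul_pow_lt_one (K : ℕ) {κ : ℝ} (hκ : 0 < κ) :
    ∃ N : ℕ, ∀ n r : ℕ, N ≤ n → κ * n ≤ r + 1 →
      2 * ((K + 1) * (n + 1) ^ K) * (2 / 3 : ℝ) ^ r < 1 := by
  set M : ℝ := 3 * (K + 1) * (1 / κ + 1) ^ K with hM
  have hM0 : 0 < M := by positivity
  have hlim := tendsto_pow_const_mul_const_pow_of_abs_lt_one K
    (r := (2 / 3 : ℝ)) (by rw [abs_of_pos] <;> norm_num)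
  obtain ⟨R, hR⟩ := Filter.eventually_atTop.1
    (hlim.eventually_lt_const (show (0 : ℝ) < 1 / M by positivity))
  refine ⟨⌈R / κ⌉₊, fun n r hn hr => ?_⟩
  have hRr : R ≤ r + 1 := by
    have h1 : (R : ℝ) / κ ≤ n := (Nat.le_ceil _).trans (by exact_mod_cast hn)
    rw [div_le_iff₀ hκ] at h1
    have : (R : ℝ) ≤ r + 1 := by linarith
    exact_mod_cast this
  have h1 := hR (r + 1) hRr
  rw [lt_div_iff₀ hM0] at h1
  push_cast at h1
  have h2 : (n + 1 : ℝ) ≤ (1 / κ + 1) * (r + 1) := by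
    have : (n : ℝ) ≤ (r + 1) / κ := by rw [le_div_iff₀ hκ]; linarith
    have hr0 : (0 : ℝ) ≤ r := r.cast_nonneg
    calc (n + 1 : ℝ) ≤ (r + 1) / κ + (r + 1) := by linarith
      _ = _ := by ring
  calc 2 * ((K + 1) * (n + 1) ^ K) * (2 / 3 : ℝ) ^ r
      ≤ 2 * ((K + 1) * ((1 / κ + 1) * (r + 1)) ^ K) * (2 / 3 : ℝ) ^ r := by gcongr
    _ = ((r : ℝ) + 1) ^ K * (2 / 3) ^ (r + 1) * M := by rw [hM, mul_pow, pow_succ]; ring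
    _ < 1 := h1

lemma exists_piece_size (K : ℕ) {ε α : ℝ} (hε0 : 0 < ε) (hα : 0 < α) :
    ∃ N : ℕ, 0 < N ∧ ∀ n : ℕ, N ≤ n → ∃ c r : ℕ, 0 < c ∧ 4 / ε ≤ c ∧ (c : ℝ) ≤ α * n ∧
      α * n ≤ 2 * c ∧ (r : ℝ) ≤ ε / 4 * c / 2 ∧
      2 * ((K + 1) * (n + 1) ^ K) * (2 / 3 : ℝ) ^ r < 1 := by
  obtain ⟨N₁, hN₁⟩ := exists_forall_mul_pow_lt_one K (κ := ε * α / 16) (by positivity)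
  refine ⟨max (N₁ + 1) ⌈(4 / ε + 1) / α⌉₊, by positivity, fun n hn => ?_⟩
  have hn1 : N₁ ≤ n := by omega
  have hn2 : 4 / ε + 1 ≤ α * n := by
    have : (4 / ε + 1) / α ≤ n :=
      (Nat.le_ceil _).trans (by exact_mod_cast (le_max_right _ _).trans hn)
    rw [div_le_iff₀ hα] at this
    linarith
  have h4 : 0 < 4 / ε := by positivity
  have hfl := Nat.lt_floor_add_one (α * n)
  have hc1 : 4 / ε ≤ (⌊α * n⌋₊ : ℝ) := by linarith
  have hc0 : 1 ≤ ⌊α * n⌋₊ := Nat.le_floor (by push_cast; linarith)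
  have hc0' : (1 : ℝ) ≤ (⌊α * n⌋₊ : ℝ) := by exact_mod_cast hc0
  have hc2 : α * n ≤ 2 * (⌊α * n⌋₊ : ℝ) := by linarith
  refine ⟨⌊α * n⌋₊, ⌊ε / 4 * (⌊α * n⌋₊ : ℝ) / 2⌋₊, hc0, hc1, Nat.floor_le (by linarith), hc2,
    Nat.floor_le (by positivity), hN₁ n _ hn1 ?_⟩
  have h := Nat.lt_floor_add_one (ε / 4 * (⌊α * n⌋₊ : ℝ) / 2)
  have : ε * (α * n) ≤ ε * (2 * (⌊α * n⌋₊ : ℝ)) := mul_le_mul_of_nonneg_left hc2 hε0.le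
  linarith

lemma exists_excellent_equipartition {K c r : ℕ} {ε : ℝ} (hε0 : 0 < ε)
    (hε1 : 2 ^ (K + 1) * ε ≤ 1) (hG : NoTreeProp G (K + 1)) {A : Finset V} (hA : A.Nonempty)
    (hc : 0 < c) (hcε : 4 / ε ≤ c)
    (hcA : (c : ℝ) ≤ (ε / 4) ^ (K + 1) / (1 + ε / 4) * A.card)
    (hr : (r : ℝ) ≤ ε / 4 * c / 2)
    (hbig : 2 * ((K + 1) * (A.card + 1) ^ K) * (2 / 3 : ℝ) ^ r < 1) :
    ∃ (p : ℕ) (P : Fin p → Finset V), p * c ≤ A.card ∧ (∀ i, P i ⊆ A) ∧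
      (∀ i j, i ≠ j → Disjoint (P i) (P j)) ∧ (∀ a ∈ A, ∃ i, a ∈ P i) ∧
      (∀ i j, |((P i).card : ℤ) - ((P j).card : ℤ)| ≤ 1) ∧ ∀ i, Excellent G ε ε (P i) := by
  have h2K : (1 : ℝ) ≤ 2 ^ (K + 1) := one_le_pow₀ one_le_two
  have hε : ε ≤ 1 := by nlinarith
  have hApos : (0 : ℝ) < A.card := by exact_mod_cast hA.card_pos
  have hc' : (0 : ℝ) < c := by exact_mod_cast hc
  obtain ⟨p, P, R, hPA, hRA, hPd, hPR, hcov, hPc, hR, hcard⟩ :=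
    exists_maximal_packing (γ := (ε / 4) ^ K) hc A fun R hRA hcR =>
      exists_uniform_subset_of_card hε0 hε1 hG (card_le_card hRA) hc hcR hr hbig
  have hcardR : (p * c + R.card : ℝ) = A.card := by exact_mod_cast hcard
  have hRle : (1 + ε / 4) * (R.card : ℝ) ≤ ε / 4 * A.card := by
    have hγ : 0 < (ε / 4) ^ K := by positivity
    have h1 : (ε / 4) ^ K * R.card < (ε / 4) ^ (K + 1) / (1 + ε / 4) * A.card := hR.trans_le hcA
    rw [pow_succ, mul_div_assoc, mul_assoc] at h1
    have h2 := lt_of_mul_lt_mul_left h1 hγ.le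
    rw [div_mul_eq_mul_div, lt_div_iff₀ (by positivity)] at h2
    linarith
  have hRp : (R.card : ℝ) ≤ ε / 4 * c * p := by nlinarith
  have hp : 0 < p := by
    rcases Nat.eq_zero_or_pos p with rfl | h
    · simp only [Nat.cast_zero, zero_mul, zero_add, mul_zero] at hcardR hRp
      linarith
    · exact h
  have hp' : (0 : ℝ) < p := by exact_mod_cast hp
  obtain ⟨E, hER, hEd, hEcov, hEc⟩ := exists_equitable_split R hp
  have hE : ∀ i, ((E i).card : ℝ) ≤ ε / 2 * c := by
    intro i
    have h1 : ((E i).card : ℝ) ≤ (R.card / p : ℕ) + 1 := by exact_mod_cast (hEc i).2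
    have h2 : ((R.card / p : ℕ) : ℝ) ≤ (R.card : ℝ) / p := Nat.cast_div_le
    have h3 : (R.card : ℝ) / p ≤ ε / 4 * c := (div_le_iff₀ hp').2 hRp
    have h4 : 1 ≤ ε / 4 * c := by
      rw [div_le_iff₀ hε0] at hcε
      linarith
    linarith
  have hPE : ∀ i j, Disjoint (P i) (E j) := fun i j => (hPR i).mono_right (hER j)
  refine ⟨p, fun i => P i ∪ E i, by omega, ?_, ?_, ?_, ?_, ?_⟩
  · exact fun i => union_subset (hPA i) ((hER i).trans hRA)
  · intro i j hij
    simp only [disjoint_union_left, disjoint_union_right]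
    exact ⟨⟨hPd i j hij, (hPE j i).symm⟩, hPE i j, hEd i j hij⟩
  · intro a ha
    rcases hcov a ha with h | ⟨i, hi⟩
    · obtain ⟨i, hi⟩ := hEcov a h
      exact ⟨i, mem_union_right _ hi⟩
    · exact ⟨i, mem_union_left _ hi⟩
  · intro i j
    simp only [card_union_of_disjoint (hPE _ _), (hPc _).1]
    have := hEc i
    have := hEc j
    rw [abs_le]
    omega
  · exact fun i => excellent_union hε0 hε (hPE i i) (hPc i).1 (hE i) (hPc i).2

lemma NoTreeProp.isEmpty (hG : NoTreeProp G 0) : IsEmpty V :=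
  ⟨fun v => hG ⟨fun _ => v, fun m => m.elim0, fun _ m => m.elim0⟩⟩

end Main

end Paper

open Paper

theorem stmt0 (ks kss : ℕ) (ε : ℝ) (hε0 : 0 < ε) (hε1 : ε < 1 / 2 ^ kss) :
    ∃ m N : ℕ, (m : ℝ) ≤ (3 + ε) * (8 / ε) ^ kss ∧
      ∀ (V : Type) [Fintype V] (G : SimpleGraph V),
        NoOrderProp G ks → NoTreeProp G kss →
        ∀ A : Finset V, N ≤ A.card →
          ∃ istar : ℕ, istar ≤ m ∧
            ∃ P : Fin istar → Finset V,
              (∀ i, P i ⊆ A) ∧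
              (∀ i j, i ≠ j → Disjoint (P i) (P j)) ∧
              (∀ a ∈ A, ∃ i, a ∈ P i) ∧
              (∀ i j, |((P i).card : ℤ) - ((P j).card : ℤ)| ≤ 1) ∧
              (∀ i, Excellent G ε ε (P i)) ∧
              (∀ i j, i ≠ j → Uniform G ε ε (P i) (P j)) := by
  rcases kss with _ | K
  · refine ⟨0, 0, by simp only [Nat.cast_zero, pow_zero]; linarith, fun V _ G _ hG A _ => ?_⟩
    have := hG.isEmpty
    exact ⟨0, le_rfl, Fin.elim0, fun i => i.elim0, fun i => i.elim0, fun a => isEmptyElim a,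
      fun i => i.elim0, fun i => i.elim0, fun i => i.elim0⟩
  have hε2 : 2 ^ (K + 1) * ε ≤ 1 := by
    rw [lt_div_iff₀ (by positivity)] at hε1
    linarith
  set α : ℝ := (ε / 4) ^ (K + 1) / (1 + ε / 4) with hα
  have hα0 : 0 < α := by positivity
  obtain ⟨N, hN0, hN⟩ := exists_piece_size K hε0 hα0
  refine ⟨⌊(3 + ε) * (8 / ε) ^ (K + 1)⌋₊, N, Nat.floor_le (by positivity),
    fun V _ G _ hG A hA => ?_⟩
  obtain ⟨c, r, hc, hcε, hcA, hAc, hr, hbig⟩ := hN A.card hA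
  obtain ⟨p, P, hp, hPA, hPd, hcov, hbal, hexc⟩ := exists_excellent_equipartition hε0 hε2 hG
    (card_pos.1 (hN0.trans_le hA)) hc hcε hcA hr hbig
  refine ⟨p, Nat.le_floor ?_, P, hPA, hPd, hcov, hbal, hexc,
    fun i j _ => (hexc i).2 _ (hexc j).1⟩
  have hc' : (0 : ℝ) < c := by exact_mod_cast hc
  have hpc : (p * c : ℝ) ≤ A.card := by exact_mod_cast hp
  have hpα : p * α ≤ 2 := by
    refine le_of_mul_le_mul_right ?_ hc'
    nlinarith
  have hpow : (8 / ε) ^ (K + 1) = 2 ^ (K + 1) / (ε / 4) ^ (K + 1) := by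
    rw [← div_pow]
    congr 1
    field_simp
    norm_num
  have h2K : (1 : ℝ) ≤ 2 ^ (K + 1) := one_le_pow₀ one_le_two
  have hα' : α * (1 + ε / 4) = (ε / 4) ^ (K + 1) := by
    rw [hα]
    field_simp
  rw [hpow, ← mul_div_assoc, le_div_iff₀ (by positivity), ← hα']
  nlinarith
end

section
/- Let k*, n_2 ∈ ℕ with n_2 > (2k*)². Then there exists N ∈ ℕ such that every finite graph G with |G| > N having the non-k*-order property admits a partition ⟨G_i : i < m⟩ of its vertex set such that: (1) |G_i| ∈ {n_2, n_2+1} for each i < m; (2) for each i there is G_i′ ⊆ G_i with |G_i ∖ G_i′| ≤ 1 such that the induced subgraph on G_i′ is either complete or edge-free; and (3) for all i ≠ j < m there are G_i′ ⊆ G_i and G_j′ ⊆ G_j, each omitting at most one vertex, and a truth value t ∈ {0,1}, such that for all but at most 2k* elements a ∈ G_i′, for all but at most 2k* elements b ∈ G_j′, (a R b) ≡ t. -/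
open Finset

open scoped Classical

open Paper

/-- Finite hypergraph Ramsey theorem, with a prescribed target size for each colour. -/
theorem exists_monochromatic {κ : Type} [Fintype κ] (r : ℕ) (n : κ → ℕ) :
    ∃ N : ℕ, ∀ (α : Type) (S : Finset α) (f : Finset α → κ), N ≤ S.card →
      ∃ c : κ, ∃ H ⊆ S, H.card = n c ∧ ∀ T ⊆ H, T.card = r → f T = c := by
  induction r generalizing n with
  | zero =>
    refine ⟨∑ c, n c, fun α S f hS => ⟨f ∅, ?_⟩⟩
    obtain ⟨H, hH, hc⟩ := Finset.exists_subset_card_eq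
      ((Finset.single_le_sum (fun _ _ => Nat.zero_le _) (Finset.mem_univ (f ∅))).trans hS :
        n (f ∅) ≤ S.card)
    exact ⟨H, hH, hc, fun T _ hT => by rw [Finset.card_eq_zero.1 hT]⟩
  | succ r ihr =>
    induction hs : ∑ c, n c using Nat.strong_induction_on generalizing n with
    | _ s ih =>
      by_cases h0 : ∃ c, n c = 0
      · obtain ⟨c, hc⟩ := h0
        refine ⟨0, fun α S f _ => ⟨c, ∅, Finset.empty_subset _, by simp [hc], ?_⟩⟩
        intro T hT hcard
        rw [Finset.subset_empty.1 hT] at hcard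
        simp at hcard
      · push Not at h0
        have hdec : ∀ c, ∃ N : ℕ, ∀ (α : Type) (S : Finset α) (f : Finset α → κ), N ≤ S.card →
            ∃ d : κ, ∃ H ⊆ S, H.card = Function.update n c (n c - 1) d ∧
              ∀ T ⊆ H, T.card = r + 1 → f T = d := by
          intro c
          refine ih _ ?_ (Function.update n c (n c - 1)) rfl
          rw [← hs]
          refine Finset.sum_lt_sum (fun d _ => ?_) ⟨c, Finset.mem_univ c, ?_⟩
          · by_cases hd : d = c
            · subst hd; simp
            · simp [hd]
          · have := h0 c
            simp only [Function.update_self]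
            omega
        choose M hM using hdec
        obtain ⟨N, hN⟩ := ihr M
        refine ⟨N + 1, fun α S f hS => ?_⟩
        obtain ⟨x, hx⟩ := Finset.card_pos.1 (by omega : 0 < S.card)
        obtain ⟨c, H, hHS, hHc, hHf⟩ := hN α (S.erase x) (fun T => f (insert x T))
          (by rw [Finset.card_erase_of_mem hx]; omega)
        obtain ⟨d, K, hKH, hKc, hKf⟩ := hM c α H f hHc.ge
        have hKS : K ⊆ S := (hKH.trans hHS).trans (Finset.erase_subset _ _)
        by_cases hd : d = c
        · subst hd
          have hxK : x ∉ K := fun h => Finset.notMem_erase x S (hHS (hKH h))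
          refine ⟨d, insert x K, Finset.insert_subset hx hKS, ?_, ?_⟩
          · rw [Finset.card_insert_of_notMem hxK, hKc, Function.update_self]
            have := h0 d
            omega
          · intro T hT hcard
            by_cases hxT : x ∈ T
            · have hsub : T.erase x ⊆ K := by
                intro z hz
                rw [Finset.mem_erase] at hz
                exact (Finset.mem_insert.1 (hT hz.2)).resolve_left hz.1
              have := hHf (T.erase x) (hsub.trans hKH)
                (by rw [Finset.card_erase_of_mem hxT]; omega)
              simpa [Finset.insert_erase hxT] using this
            · refine hKf T (fun z hz => ?_) hcard
              exact (Finset.mem_insert.1 (hT hz)).resolve_left (fun h => hxT (h ▸ hz))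
        · exact ⟨d, K, hKS, by simpa [hd] using hKc, hKf⟩

/-- The number of elements of `T` placed before `x` by `e`. -/
noncomputable def rankIn {V : Type} (e : V → ℕ) (T : Finset V) (x : V) : ℕ :=
  (T.filter fun z => e z < e x).card

theorem exists_enumeration {V : Type} {e : V → ℕ} (he : Function.Injective e) (T : Finset V) :
    ∃ a : Fin T.card → V, ∀ i, a i ∈ T ∧ rankIn e T (a i) = i := by
  have hlt : ∀ x ∈ T, ∀ y ∈ T, e x < e y → rankIn e T x < rankIn e T y := by
    intro x hx y _ hxy
    refine Finset.card_lt_card (Finset.ssubset_iff_of_subset ?_ |>.2 ⟨x, ?_, ?_⟩)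
    · intro z hz
      simp only [Finset.mem_filter] at hz ⊢
      exact ⟨hz.1, hz.2.trans hxy⟩
    · simp [hx, hxy]
    · simp
  have hinj : Set.InjOn (rankIn e T) T := by
    intro x hx y hy hxy
    by_contra hne
    rcases lt_or_gt_of_ne (he.ne hne) with h | h
    · exact (hlt x hx y hy h).ne hxy
    · exact (hlt y hy x hx h).ne' hxy
  have himg : T.image (rankIn e T) = Finset.range T.card := by
    refine Finset.eq_of_subset_of_card_le ?_ ?_
    · intro i hi
      obtain ⟨x, hx, rfl⟩ := Finset.mem_image.1 hi
      refine Finset.mem_range.2 (Finset.card_lt_card ?_)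
      exact Finset.filter_ssubset.2 ⟨x, hx, by simp⟩
    · rw [Finset.card_image_of_injOn hinj, Finset.card_range]
  have hsurj : ∀ i : Fin T.card, ∃ x, x ∈ T ∧ rankIn e T x = i := by
    intro i
    have : (i : ℕ) ∈ T.image (rankIn e T) := by rw [himg]; exact Finset.mem_range.2 i.2
    exact Finset.mem_image.1 this
  choose a ha using hsurj
  exact ⟨a, ha⟩

/-- If `X` lies before `Y`, some `k`-subset of `X ∪ Y` has its first `j` elements in `X` and the
others in `Y`. -/
theorem exists_cut_subset {V : Type} {e : V → ℕ} {X Y : Finset V} {c k j : ℕ}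
    (hX : ∀ x ∈ X, e x < c) (hY : ∀ y ∈ Y, c ≤ e y) (hXk : k ≤ X.card) (hYk : k ≤ Y.card)
    (hj : j ≤ k) :
    ∃ T ⊆ X ∪ Y, T.card = k ∧
      ∀ x ∈ T, (x ∈ X ∧ rankIn e T x < j) ∨ (x ∈ Y ∧ ¬ rankIn e T x < j) := by
  obtain ⟨X', hX', hXc⟩ := Finset.exists_subset_card_eq (hj.trans hXk)
  obtain ⟨Y', hY', hYc⟩ := Finset.exists_subset_card_eq ((Nat.sub_le k j).trans hYk)
  refine ⟨X' ∪ Y', Finset.union_subset_union hX' hY', ?_, ?_⟩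
  · rw [Finset.card_union_of_disjoint, hXc, hYc]
    · omega
    · rw [Finset.disjoint_left]
      intro x hx hy
      exact absurd (hX x (hX' hx)) (not_lt.2 (hY x (hY' hy)))
  · intro x hx
    rcases Finset.mem_union.1 hx with h | h
    · refine Or.inl ⟨hX' h, ?_⟩
      rw [← hXc]
      refine Finset.card_lt_card (Finset.ssubset_iff_of_subset ?_ |>.2 ⟨x, h, by simp⟩)
      intro z hz
      rw [Finset.mem_filter, Finset.mem_union] at hz
      refine hz.1.resolve_right fun hzY => ?_
      have := hX x (hX' h)
      have := hY z (hY' hzY)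
      omega
    · refine Or.inr ⟨hY' h, not_lt.2 ?_⟩
      rw [← hXc]
      refine Finset.card_le_card fun z hz => ?_
      rw [Finset.mem_filter, Finset.mem_union]
      exact ⟨Or.inl hz, (hX z (hX' hz)).trans_le (hY x (hY' h))⟩

theorem exists_threshold {V : Type} {e : V → ℕ} (he : Function.Injective e) {X Y : Finset V}
    {k : ℕ} (hX : 2 * k ≤ X.card) (hY : 2 * k ≤ Y.card) :
    ∃ c, (k ≤ (X.filter fun x => e x < c).card ∧ k ≤ (Y.filter fun y => c ≤ e y).card) ∨
      (k ≤ (Y.filter fun y => e y < c).card ∧ k ≤ (X.filter fun x => c ≤ e x).card) := by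
  have hsplit : ∀ (Z : Finset V) c,
      (Z.filter fun x => e x < c).card + (Z.filter fun x => c ≤ e x).card = Z.card := by
    intro Z c
    have := Finset.card_filter_add_card_filter_not (s := Z) (fun x => e x < c)
    simpa only [not_lt] using this
  have hex : ∃ c, k ≤ (X.filter fun x => e x < c).card := by
    refine ⟨X.sup e + 1, ?_⟩
    rw [Finset.filter_true_of_mem fun x hx => Nat.lt_succ_of_le (Finset.le_sup hx)]
    omega
  have hc := Nat.find_spec hex
  have hmin : ∀ d < Nat.find hex, (X.filter fun x => e x < d).card < k := fun d hd =>
    not_le.1 (Nat.find_min hex hd)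
  generalize Nat.find hex = c at hc hmin
  have hle : (X.filter fun x => e x < c).card ≤ k := by
    cases c with
    | zero => simp
    | succ d =>
      have h1 := hmin d (Nat.lt_succ_self d)
      have h2 : (X.filter fun x => e x < d + 1) ⊆
          (X.filter fun x => e x < d) ∪ (X.filter fun x => e x = d) := by
        intro x hx
        simp only [Finset.mem_filter, Finset.mem_union] at hx ⊢
        rcases Nat.lt_succ_iff_lt_or_eq.1 hx.2 with h | h
        · exact Or.inl ⟨hx.1, h⟩
        · exact Or.inr ⟨hx.1, h⟩
      have h3 : (X.filter fun x => e x = d).card ≤ 1 := by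
        refine Finset.card_le_one.2 fun x hx y hy => he ?_
        rw [(Finset.mem_filter.1 hx).2, (Finset.mem_filter.1 hy).2]
      have h4 := Finset.card_le_card h2
      have h5 := Finset.card_union_le (X.filter fun x => e x < d) (X.filter fun x => e x = d)
      omega
  refine ⟨c, ?_⟩
  have := hsplit X c
  have := hsplit Y c
  by_cases h : k ≤ (Y.filter fun y => c ≤ e y).card
  · exact Or.inl ⟨hc, h⟩
  · exact Or.inr ⟨by omega, by omega⟩

/-- Every vertex is adjacent to fewer than `d` or non-adjacent to fewer than `d` elements
of `H`. -/
def FewExceptions {V : Type} (G : SimpleGraph V) (d : ℕ) (H : Finset V) : Prop :=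
  ∀ y : V, ∃ t : Bool, (H.filter fun x => ¬ (G.Adj y x ↔ t = true)).card < d

theorem FewExceptions.mono {V : Type} {G : SimpleGraph V} {d : ℕ} {H K : Finset V}
    (hH : FewExceptions G d H) (hK : K ⊆ H) : FewExceptions G d K := fun y =>
  (hH y).imp fun _ ht => (Finset.card_le_card (Finset.filter_subset_filter _ hK)).trans_lt ht

theorem hasOrderProp_of_initial_segments {V : Type} {G : SimpleGraph V} {e : V → ℕ}
    (he : Function.Injective e) {T : Finset V}
    (h : ∀ j ≤ T.card, ∃ y, ∀ x ∈ T, G.Adj y x ↔ rankIn e T x < j) :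
    HasOrderProp G T.card := by
  obtain ⟨a, ha⟩ := exists_enumeration he T
  choose b hb using fun j : Fin T.card => h j j.2.le
  refine ⟨a, b, fun i j hij => ?_⟩
  rw [G.adj_comm, hb j _ (ha i).1, G.adj_comm, hb i _ (ha j).1, (ha i).2, (ha j).2]
  exact ⟨hij, not_lt.2 (Fin.le_def.1 hij.le)⟩

theorem hasOrderProp_of_final_segments {V : Type} {G : SimpleGraph V} {e : V → ℕ}
    (he : Function.Injective e) {T : Finset V}
    (h : ∀ j ≤ T.card, ∃ y, ∀ x ∈ T, G.Adj y x ↔ ¬ rankIn e T x < j) :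
    HasOrderProp G T.card := by
  obtain ⟨a, ha⟩ := exists_enumeration he T
  choose b hb using fun j : Fin T.card => h (T.card - j) (Nat.sub_le _ _)
  refine ⟨fun i => a i.rev, b, fun i j hij => ?_⟩
  rw [G.adj_comm, hb j _ (ha i.rev).1, G.adj_comm, hb i _ (ha j.rev).1, (ha i.rev).2,
    (ha j.rev).2, Fin.val_rev, Fin.val_rev]
  have := Fin.lt_def.1 hij
  omega

/-- Large vertex sets of a graph with the non-`k`-order property contain large subsets with few
exceptions. -/
theorem exists_fewExceptions (k n : ℕ) :
    ∃ N : ℕ, ∀ (V : Type) [Fintype V] (G : SimpleGraph V), NoOrderProp G k →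
      ∀ S : Finset V, N ≤ S.card → ∃ H ⊆ S, H.card = n ∧ FewExceptions G (2 * k) H := by
  obtain ⟨N, hN⟩ := exists_monochromatic (κ := (Fin (k + 1) → Prop) × (Fin (k + 1) → Prop)) k
    (fun _ => n + k)
  refine ⟨N, fun V _ G hG S hS => ?_⟩
  obtain ⟨e, he⟩ : ∃ e : V → ℕ, Function.Injective e :=
    ⟨fun v => Fintype.equivFin V v, Fin.val_injective.comp (Fintype.equivFin V).injective⟩
  obtain ⟨c, H, hHS, hHc, hHf⟩ := hN V S
    (fun T => (fun j => ∃ y, ∀ x ∈ T, G.Adj y x ↔ rankIn e T x < j,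
      fun j => ∃ y, ∀ x ∈ T, G.Adj y x ↔ ¬ rankIn e T x < j)) hS
  have hfew : FewExceptions G (2 * k) H := by
    intro y
    by_contra! hy
    obtain ⟨T, hTH, hTc⟩ := Finset.exists_subset_card_eq (by omega : k ≤ H.card)
    have hO : 2 * k ≤ (H.filter fun x => G.Adj y x).card := by simpa using hy false
    have hZ : 2 * k ≤ (H.filter fun x => ¬ G.Adj y x).card := by simpa using hy true
    obtain ⟨d, ⟨h1, h2⟩ | ⟨h1, h2⟩⟩ := exists_threshold he hO hZ
    · refine hG (hTc ▸ hasOrderProp_of_initial_segments he (T := T) fun j hj => ?_)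
      rw [hTc] at hj
      obtain ⟨U, hU, hUc, hUr⟩ := exists_cut_subset (e := e) (c := d)
        (fun x hx => (Finset.mem_filter.1 hx).2) (fun x hx => (Finset.mem_filter.1 hx).2) h1 h2 hj
      have hUH : U ⊆ H := fun x hx => by
        have := hU hx
        simp only [Finset.mem_union, Finset.mem_filter] at this
        tauto
      have heq := congrFun (congrArg Prod.fst ((hHf T hTH hTc).trans (hHf U hUH hUc).symm))
        ⟨j, Nat.lt_succ_of_le hj⟩
      refine heq.mpr ⟨y, fun x hx => ?_⟩
      rcases hUr x hx with ⟨h, h'⟩ | ⟨h, h'⟩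
      · exact iff_of_true (Finset.mem_filter.1 (Finset.mem_filter.1 h).1).2 h'
      · exact iff_of_false (Finset.mem_filter.1 (Finset.mem_filter.1 h).1).2 h'
    · refine hG (hTc ▸ hasOrderProp_of_final_segments he (T := T) fun j hj => ?_)
      rw [hTc] at hj
      obtain ⟨U, hU, hUc, hUr⟩ := exists_cut_subset (e := e) (c := d)
        (fun x hx => (Finset.mem_filter.1 hx).2) (fun x hx => (Finset.mem_filter.1 hx).2) h1 h2 hj
      have hUH : U ⊆ H := fun x hx => by
        have := hU hx
        simp only [Finset.mem_union, Finset.mem_filter] at this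
        tauto
      have heq := congrFun (congrArg Prod.snd ((hHf T hTH hTc).trans (hHf U hUH hUc).symm))
        ⟨j, Nat.lt_succ_of_le hj⟩
      refine heq.mpr ⟨y, fun x hx => ?_⟩
      rcases hUr x hx with ⟨h, h'⟩ | ⟨h, h'⟩
      · exact iff_of_false (Finset.mem_filter.1 (Finset.mem_filter.1 h).1).2 (not_not.2 h')
      · exact iff_of_true (Finset.mem_filter.1 (Finset.mem_filter.1 h).1).2 h'
  obtain ⟨K, hKH, hKc⟩ := Finset.exists_subset_card_eq (by omega : n ≤ H.card)
  exact ⟨K, hKH.trans hHS, hKc, hfew.mono hKH⟩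

/-- `H` is complete or edge-free in `G`. -/
def Homogeneous {V : Type} (G : SimpleGraph V) (H : Finset V) : Prop :=
  (∀ a ∈ H, ∀ b ∈ H, a ≠ b → G.Adj a b) ∨ (∀ a ∈ H, ∀ b ∈ H, ¬ G.Adj a b)

theorem exists_homogeneous (n : ℕ) :
    ∃ N : ℕ, ∀ (V : Type) (G : SimpleGraph V) (S : Finset V), N ≤ S.card →
      ∃ H ⊆ S, H.card = n ∧ Homogeneous G H := by
  obtain ⟨N, hN⟩ := exists_monochromatic (κ := Prop) 2 (fun _ => n)
  refine ⟨N, fun V G S hS => ?_⟩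
  obtain ⟨c, H, hHS, hHc, hHf⟩ := hN V S (fun T => ∀ a ∈ T, ∀ b ∈ T, a ≠ b → G.Adj a b) hS
  refine ⟨H, hHS, hHc, ?_⟩
  have key : ∀ a ∈ H, ∀ b ∈ H, a ≠ b → (G.Adj a b ↔ c) := by
    intro a ha b hb hab
    have h := hHf {a, b} (by simp [Finset.insert_subset_iff, ha, hb]) (Finset.card_pair hab)
    rw [← h]
    constructor
    · intro hadj x hx y hy hxy
      simp only [Finset.mem_insert, Finset.mem_singleton] at hx hy
      rcases hx with rfl | rfl <;> rcases hy with rfl | rfl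
      · exact absurd rfl hxy
      · exact hadj
      · exact hadj.symm
      · exact absurd rfl hxy
    · intro h
      exact h a (by simp) b (by simp) hab
  by_cases hc : c
  · exact Or.inl fun a ha b hb hab => (key a ha b hb hab).2 hc
  · exact Or.inr fun a ha b hb hadj => hc ((key a ha b hb hadj.ne).1 hadj)

/-- Between two large sets with few exceptions, almost all adjacencies agree. -/
theorem FewExceptions.exists_uniform {V : Type} {G : SimpleGraph V} {d : ℕ} {A B : Finset V}
    (hA : FewExceptions G d A) (hB : FewExceptions G d B) (hBc : 2 * d * d < B.card) :
    ∃ t : Bool,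
      (A.filter fun a => d ≤ (B.filter fun b => ¬ (G.Adj a b ↔ t = true)).card).card < d := by
  choose t ht using hB
  suffices h : ∃ s : Bool, (A.filter fun a => t a = !s).card < d by
    obtain ⟨s, hs⟩ := h
    refine ⟨s, (Finset.card_le_card fun a ha => ?_).trans_lt hs⟩
    rw [Finset.mem_filter] at ha ⊢
    refine ⟨ha.1, ?_⟩
    by_contra hne
    have hts : t a = s := by simpa using hne
    exact absurd (hts ▸ ht a) (not_lt.2 ha.2)
  by_contra! h
  obtain ⟨X, hX, hXc⟩ := Finset.exists_subset_card_eq (h true)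
  obtain ⟨Y, hY, hYc⟩ := Finset.exists_subset_card_eq (h false)
  have hbad : ((X ∪ Y).biUnion fun a => B.filter fun b => ¬ (G.Adj a b ↔ t a = true)).card
      < B.card := by
    refine lt_of_le_of_lt (Finset.card_biUnion_le_card_mul _ _ d fun a _ => (ht a).le) ?_
    refine lt_of_le_of_lt (Nat.mul_le_mul_right d (Finset.card_union_le X Y)) ?_
    rwa [hXc, hYc, ← two_mul]
  obtain ⟨b, hbB, hb⟩ := Finset.exists_mem_notMem_of_card_lt_card hbad
  have hgood : ∀ a ∈ X ∪ Y, (G.Adj b a ↔ t a = true) := by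
    intro a ha
    by_contra hne
    rw [G.adj_comm] at hne
    exact hb (Finset.mem_biUnion.2 ⟨a, ha, Finset.mem_filter.2 ⟨hbB, hne⟩⟩)
  obtain ⟨s, hs⟩ := hA b
  refine absurd hs (not_lt.2 ?_)
  cases s
  · rw [← hYc]
    refine Finset.card_le_card fun a ha => ?_
    have h1 := Finset.mem_filter.1 (hY ha)
    have h2 := hgood a (Finset.mem_union_right _ ha)
    rw [Finset.mem_filter]
    refine ⟨h1.1, ?_⟩
    simp [h2, h1.2]
  · rw [← hXc]
    refine Finset.card_le_card fun a ha => ?_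
    have h1 := Finset.mem_filter.1 (hX ha)
    have h2 := hgood a (Finset.mem_union_left _ ha)
    rw [Finset.mem_filter]
    refine ⟨h1.1, ?_⟩
    simp [h2, h1.2]

/-- If every set of size at least `N` contains a nonempty set satisfying `p`, then all but fewer
than `N` elements are covered by a disjoint family of sets satisfying `p`. -/
theorem exists_disjoint_family {V : Type} {p : Finset V → Prop} {N : ℕ}
    (hp : ∀ A, p A → A.Nonempty) (hN : ∀ S : Finset V, N ≤ S.card → ∃ A ⊆ S, p A)
    (S : Finset V) :
    ∃ F : Finset (Finset V), (∀ A ∈ F, p A ∧ A ⊆ S) ∧ (F : Set (Finset V)).PairwiseDisjoint id ∧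
      (S \ F.biUnion id).card < N := by
  induction hs : S.card using Nat.strong_induction_on generalizing S with
  | _ s ih =>
    by_cases h : N ≤ S.card
    · obtain ⟨A, hAS, hA⟩ := hN S h
      have hlt : (S \ A).card < s := by
        rw [← hs]
        exact Finset.card_lt_card (Finset.sdiff_ssubset hAS (hp A hA))
      obtain ⟨F, hF, hdisj, hcard⟩ := ih _ hlt (S \ A) rfl
      refine ⟨insert A F, ?_, ?_, ?_⟩
      · intro B hB
        rcases Finset.mem_insert.1 hB with rfl | hB
        · exact ⟨hA, hAS⟩
        · exact ⟨(hF B hB).1, (hF B hB).2.trans Finset.sdiff_subset⟩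
      · rw [Finset.coe_insert]
        refine hdisj.insert fun B hB _ => ?_
        exact (Finset.disjoint_of_subset_left (hF B hB).2 Finset.sdiff_disjoint).symm
      · rw [Finset.biUnion_insert, id, ← Finset.sup_eq_union, ← sdiff_sdiff_left]
        exact hcard
    · exact ⟨∅, by simp, by simp, by simpa using h⟩

theorem stmt4 (ks n2 : ℕ) (hn2 : (2 * ks) ^ 2 < n2) :
    ∃ N : ℕ,
      ∀ (V : Type) [Fintype V] (G : SimpleGraph V),
        N < Fintype.card V → NoOrderProp G ks →
        ∃ (m : ℕ) (P : Fin m → Finset V),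
          (∀ i j, i ≠ j → Disjoint (P i) (P j)) ∧
          (∀ v : V, ∃ i, v ∈ P i) ∧
          (∀ i, (P i).card = n2 ∨ (P i).card = n2 + 1) ∧
          (∀ i, ∃ P' ⊆ P i, (P i \ P').card ≤ 1 ∧
            ((∀ a ∈ P', ∀ b ∈ P', a ≠ b → G.Adj a b) ∨
             (∀ a ∈ P', ∀ b ∈ P', ¬ G.Adj a b))) ∧
          (∀ i j, i ≠ j →
            ∃ Pi' ⊆ P i, ∃ Pj' ⊆ P j,
              (P i \ Pi').card ≤ 1 ∧ (P j \ Pj').card ≤ 1 ∧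
              ∃ t : Bool,
                (Pi'.filter fun a =>
                    2 * ks < (Pj'.filter fun b => ¬ (G.Adj a b ↔ t = true)).card).card
                  ≤ 2 * ks) := by
  obtain ⟨N₁, hN₁⟩ := exists_homogeneous (n2 + 8 * ks * ks)
  obtain ⟨N₂, hN₂⟩ := exists_fewExceptions ks N₁
  refine ⟨N₂ * n2 + N₂, fun V _ G hV hG => ?_⟩
  obtain ⟨F, hF, hdisj, hrem⟩ := exists_disjoint_family (V := V) (N := N₂)
    (p := fun A => A.card = n2 ∧ Homogeneous G A ∧
      ∃ H, A ⊆ H ∧ 8 * ks * ks < H.card ∧ FewExceptions G (2 * ks) H)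
    (fun A hA => Finset.card_pos.1 (by have := hA.1; omega))
    (fun S hS => by
      obtain ⟨K, hKS, hKc, hK⟩ := hN₂ V G hG S hS
      obtain ⟨H, hHK, hHc, hH⟩ := hN₁ V G K hKc.ge
      obtain ⟨A, hAH, hAc⟩ := Finset.exists_subset_card_eq (by omega : n2 ≤ H.card)
      refine ⟨A, (hAH.trans hHK).trans hKS, hAc, ?_, H, hAH, by omega, hK.mono hHK⟩
      exact hH.imp (fun h a ha b hb => h a (hAH ha) b (hAH hb))
        (fun h a ha b hb => h a (hAH ha) b (hAH hb)))
    Finset.univ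
  set R : Finset V := Finset.univ \ F.biUnion id with hR
  have hcover : (F.biUnion id).card = F.card * n2 := by
    rw [Finset.card_biUnion hdisj]
    exact Finset.sum_const_nat fun A hA => (hF A hA).1.1
  have hRF : R.card ≤ F.card := by
    have h1 : R.card + F.card * n2 = Fintype.card V := by
      rw [← hcover, hR, Finset.card_sdiff_add_card_eq_card (Finset.subset_univ _),
        Finset.card_univ]
    have h2 : N₂ < F.card := by
      by_contra! h
      have := Nat.mul_le_mul_right n2 h
      omega
    omega
  obtain ⟨g⟩ : Nonempty (R ↪ Fin F.card) :=
    Function.Embedding.nonempty_of_card_le (by simpa using hRF)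
  let C : Fin F.card → Finset V := fun i => (F.equivFin.symm i).1
  have hC : ∀ i, C i ∈ F := fun i => (F.equivFin.symm i).2
  have hCR : ∀ i, ∀ v ∈ C i, v ∉ R := fun i v hv hvR =>
    (Finset.mem_sdiff.1 hvR).2 (Finset.mem_biUnion.2 ⟨C i, hC i, hv⟩)
  have hCdisj : ∀ i j, i ≠ j → Disjoint (C i) (C j) := fun i j hij =>
    hdisj (hC i) (hC j) fun h => hij (F.equivFin.symm.injective (Subtype.ext h))
  let E : Fin F.card → Finset V := fun i => (R.attach.filter fun v => g v = i).image Subtype.val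
  have hE : ∀ i v, v ∈ E i ↔ ∃ h : v ∈ R, g ⟨v, h⟩ = i := by
    intro i v
    simp [E]
  have hE1 : ∀ i, (E i).card ≤ 1 := by
    refine fun i => Finset.card_le_one.2 fun a ha b hb => ?_
    obtain ⟨ha, ha'⟩ := (hE i a).1 ha
    obtain ⟨hb, hb'⟩ := (hE i b).1 hb
    exact congrArg Subtype.val (g.injective (ha'.trans hb'.symm))
  have hCE : ∀ i j, Disjoint (C i) (E j) := fun i j =>
    Finset.disjoint_left.2 fun v hv hv' => hCR i v hv ((hE j v).1 hv').1
  have hdiff : ∀ i, ((C i ∪ E i) \ C i).card ≤ 1 := fun i =>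
    (Finset.card_le_card (by rw [Finset.union_sdiff_left]; exact Finset.sdiff_subset)).trans (hE1 i)
  refine ⟨F.card, fun i => C i ∪ E i, ?_, ?_, ?_, ?_, ?_⟩
  · intro i j hij
    rw [Finset.disjoint_union_left, Finset.disjoint_union_right, Finset.disjoint_union_right]
    refine ⟨⟨hCdisj i j hij, hCE i j⟩, (hCE j i).symm, Finset.disjoint_left.2 fun v hi hj => ?_⟩
    obtain ⟨_, hi⟩ := (hE i v).1 hi
    obtain ⟨_, hj⟩ := (hE j v).1 hj
    exact hij (hi.symm.trans hj)
  · intro v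
    by_cases hv : v ∈ R
    · exact ⟨g ⟨v, hv⟩, Finset.mem_union_right _ ((hE _ v).2 ⟨hv, rfl⟩)⟩
    · have hv' : v ∈ F.biUnion id := by simpa [hR] using hv
      obtain ⟨A, hA, hvA⟩ := Finset.mem_biUnion.1 hv'
      refine ⟨F.equivFin ⟨A, hA⟩, Finset.mem_union_left _ ?_⟩
      simpa [C] using hvA
  · intro i
    have h1 := (hF _ (hC i)).1.1
    have h2 := hE1 i
    rw [Finset.card_union_of_disjoint (hCE i i)]
    omega
  · exact fun i => ⟨C i, Finset.subset_union_left, hdiff i, (hF _ (hC i)).1.2.1⟩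
  · intro i j _
    obtain ⟨A, hiA, _, hA⟩ := (hF _ (hC i)).1.2.2
    obtain ⟨B, hjB, hBc, hB⟩ := (hF _ (hC j)).1.2.2
    obtain ⟨t, ht⟩ := hA.exists_uniform hB (by convert hBc using 1; ring)
    refine ⟨C i, Finset.subset_union_left, C j, Finset.subset_union_left, hdiff i, hdiff j, t,
      (Finset.card_le_card fun a ha => ?_).trans ht.le⟩
    rw [Finset.mem_filter] at ha ⊢
    exact ⟨hiA ha.1, ha.2.le.trans (Finset.card_le_card (Finset.filter_subset_filter _ hjB))⟩
end

section
/- Let ε ∈ (0,1), ζ > 0, ξ a real with 0 < ξ < min(1−ε, 1/2), and c ∈ ℕ with c > 1/(ζ·(1−ξ−ε)). Let n ∈ ℕ satisfy n^{−(1−2ξ)} + n^{−((1−ξ−ε)·c − 1/ζ)} < 1. Then for every finite set A with |A| = n and every family 𝒫 of subsets of A with |𝒫| ≤ n^{1/ζ} and |B| ≤ n^ε for every B ∈ 𝒫, there exists U ⊆ A with |U| = ⌊n^ξ⌋ such that |U ∩ B| ≤ c for every B ∈ 𝒫. -/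
open Finset

open scoped Classical

open Paper

theorem Nat.descFactorial_mul_pow_le {m n : ℕ} (h : m ≤ n) (c : ℕ) :
    m.descFactorial c * n ^ c ≤ m ^ c * n.descFactorial c := by
  induction c with
  | zero => simp
  | succ c ih =>
    have key : (m - c) * n ≤ m * (n - c) := by
      rw [Nat.sub_mul, Nat.mul_sub]
      have := Nat.mul_le_mul_left c h
      rw [mul_comm m c]
      omega
    calc m.descFactorial (c + 1) * n ^ (c + 1)
        = ((m - c) * n) * (m.descFactorial c * n ^ c) := by
          rw [Nat.descFactorial_succ, pow_succ]; ring
      _ ≤ (m * (n - c)) * (m ^ c * n.descFactorial c) := Nat.mul_le_mul key ih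
      _ = m ^ (c + 1) * n.descFactorial (c + 1) := by
          rw [Nat.descFactorial_succ, pow_succ]; ring

theorem Finset.card_filter_subset_powersetCard_le {α : Type*} {A T : Finset α} (hT : T ⊆ A)
    (m : ℕ) :
    #{U ∈ powersetCard m A | T ⊆ U} ≤ (#A - #T).choose (m - #T) := by
  rw [← card_sdiff_of_subset hT, ← card_powersetCard]
  refine card_le_card_of_injOn (fun U => U \ T) ?_ ?_
  · intro U hU
    rw [mem_coe, mem_filter, mem_powersetCard] at hU
    rw [mem_coe, mem_powersetCard]
    exact ⟨sdiff_subset_sdiff hU.1.1 le_rfl, by rw [card_sdiff_of_subset hU.2, hU.1.2]⟩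
  · intro U hU W hW h
    rw [mem_coe, mem_filter, mem_powersetCard] at hU hW
    rw [← sdiff_union_of_subset hU.2, ← sdiff_union_of_subset hW.2]
    exact congrArg (· ∪ T) h

/-- Union bound for the number of `m`-subsets of `A` meeting `B` in at least `c` points. -/
theorem Finset.card_filter_le_card_inter_mul_pow_le {α : Type*} {A B : Finset α} (hB : B ⊆ A)
    {m : ℕ} (hm : m ≤ #A) (c : ℕ) :
    #{U ∈ powersetCard m A | c ≤ #(U ∩ B)} * #A ^ c ≤ (#A).choose m * (m * #B) ^ c := by
  rcases lt_or_ge m c with hmc | hcm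
  · have : #{U ∈ powersetCard m A | c ≤ #(U ∩ B)} = 0 := by
      rw [card_eq_zero, filter_eq_empty_iff]
      intro U hU hc
      have h := card_le_card (inter_subset_left : U ∩ B ⊆ U)
      rw [(mem_powersetCard.1 hU).2] at h
      omega
    simp [this]
  have hcount : #{U ∈ powersetCard m A | c ≤ #(U ∩ B)}
      ≤ (#B).choose c * (#A - c).choose (m - c) := by
    have hsub : {U ∈ powersetCard m A | c ≤ #(U ∩ B)} ⊆
        (powersetCard c B).biUnion fun T => {U ∈ powersetCard m A | T ⊆ U} := by
      intro U hU
      obtain ⟨hU, hc⟩ := mem_filter.1 hU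
      obtain ⟨T, hT, hTc⟩ := exists_subset_card_eq hc
      exact mem_biUnion.2 ⟨T, mem_powersetCard.2 ⟨hT.trans inter_subset_right, hTc⟩,
        mem_filter.2 ⟨hU, hT.trans inter_subset_left⟩⟩
    refine (card_le_card hsub).trans ?_
    rw [← card_powersetCard]
    refine card_biUnion_le_card_mul _ _ _ fun T hT => ?_
    obtain ⟨hTB, rfl⟩ := mem_powersetCard.1 hT
    exact card_filter_subset_powersetCard_le (hTB.trans hB) m
  have hpos : 0 < (#A).descFactorial c := Nat.descFactorial_pos.2 (hcm.trans hm)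
  refine Nat.le_of_mul_le_mul_right ?_ hpos
  set N := #{U ∈ powersetCard m A | c ≤ #(U ∩ B)}
  calc N * #A ^ c * (#A).descFactorial c
      ≤ (#B).choose c * (#A - c).choose (m - c) * #A ^ c * (#A).descFactorial c := by gcongr
    _ = (#B).choose c * #A ^ c * c.factorial * ((#A).choose c * (#A - c).choose (m - c)) := by
        rw [Nat.descFactorial_eq_factorial_mul_choose]; ring
    _ = (#B).choose c * (#A).choose m * (m.descFactorial c * #A ^ c) := by
        rw [← Nat.choose_mul hcm, Nat.descFactorial_eq_factorial_mul_choose]; ring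
    _ ≤ #B ^ c * (#A).choose m * (m ^ c * (#A).descFactorial c) :=
        Nat.mul_le_mul (Nat.mul_le_mul_right _ (Nat.choose_le_pow _ _))
          (Nat.descFactorial_mul_pow_le hm c)
    _ = (#A).choose m * (m * #B) ^ c * (#A).descFactorial c := by ring

theorem stmt5 (ε ζ ξ : ℝ) (c n : ℕ)
    (hε : 0 < ε ∧ ε < 1) (hζ : 0 < ζ)
    (hξ : 0 < ξ ∧ ξ < min (1 - ε) (1 / 2))
    (hc : 1 / (ζ * (1 - ξ - ε)) < (c : ℝ))
    (hn : (n : ℝ) ^ (-(1 - 2 * ξ)) + (n : ℝ) ^ (-((1 - ξ - ε) * c - 1 / ζ)) < 1)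
    (α : Type) (A : Finset α) (hA : A.card = n)
    (P : Finset (Finset α)) (hPA : ∀ B ∈ P, B ⊆ A)
    (hPcard : (P.card : ℝ) ≤ (n : ℝ) ^ (1 / ζ))
    (hB : ∀ B ∈ P, (B.card : ℝ) ≤ (n : ℝ) ^ ε) :
    ∃ U ⊆ A, U.card = ⌊(n : ℝ) ^ ξ⌋₊ ∧ ∀ B ∈ P, (U ∩ B).card ≤ c := by
  obtain ⟨hξ0, hξ1⟩ := hξ
  have hξ2 : ξ < 1 := by linarith [hξ1.trans_le (min_le_right _ _)]
  rcases Nat.eq_zero_or_pos n with rfl | hpos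
  · refine ⟨∅, empty_subset _, ?_, by simp⟩
    simp [Real.zero_rpow hξ0.ne']
  have hn0 : (0 : ℝ) < n := by exact_mod_cast hpos
  have hn1 : (1 : ℝ) ≤ n := by exact_mod_cast hpos
  set m := ⌊(n : ℝ) ^ ξ⌋₊ with hm_def
  have hm : (m : ℝ) ≤ (n : ℝ) ^ ξ := Nat.floor_le (by positivity)
  have hmn : m ≤ #A := by
    rw [hA]
    have h : (n : ℝ) ^ ξ ≤ n := by
      simpa using Real.rpow_le_rpow_of_exponent_le hn1 hξ2.le
    exact_mod_cast hm.trans h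
  set M : ℝ := Nat.cast ((#A).choose m) with hM_def
  have hM : 0 < M := by
    have := Nat.choose_pos hmn
    simp only [hM_def]
    exact_mod_cast this
  have hbad : ∀ B ∈ P, (#{U ∈ powersetCard m A | c ≤ #(U ∩ B)} : ℝ)
      ≤ M * (n : ℝ) ^ (-((1 - ξ - ε) * c)) := by
    intro B hBP
    have h : (#{U ∈ powersetCard m A | c ≤ #(U ∩ B)} : ℝ) * (n : ℝ) ^ c
        ≤ M * ((m : ℝ) * #B) ^ c := by
      have h := card_filter_le_card_inter_mul_pow_le (hPA B hBP) hmn c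
      rw [← hA, hM_def]
      exact_mod_cast h
    refine le_of_mul_le_mul_right ?_ (pow_pos hn0 c)
    calc _ ≤ M * ((m : ℝ) * #B) ^ c := h
      _ ≤ M * ((n : ℝ) ^ ξ * (n : ℝ) ^ ε) ^ c := by
          gcongr
          exact hB B hBP
      _ = M * (n : ℝ) ^ (-((1 - ξ - ε) * c)) * (n : ℝ) ^ c := by
          rw [← Real.rpow_add hn0, ← Real.rpow_natCast, ← Real.rpow_mul hn0.le,
            ← Real.rpow_natCast, mul_assoc, ← Real.rpow_add hn0]
          congr 2
          ring
  have hlt : #(P.biUnion fun B => {U ∈ powersetCard m A | c ≤ #(U ∩ B)})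
      < #(powersetCard m A) := by
    rw [card_powersetCard]
    suffices h : ((#(P.biUnion fun B => {U ∈ powersetCard m A | c ≤ #(U ∩ B)}) : ℕ) : ℝ) < M by
      simp only [hM_def] at h
      exact_mod_cast h
    calc ((#(P.biUnion fun B => {U ∈ powersetCard m A | c ≤ #(U ∩ B)}) : ℕ) : ℝ)
        ≤ ∑ B ∈ P, (#{U ∈ powersetCard m A | c ≤ #(U ∩ B)} : ℝ) := by
          exact_mod_cast card_biUnion_le
      _ ≤ #P * (M * (n : ℝ) ^ (-((1 - ξ - ε) * c))) := by
          simpa using sum_le_sum hbad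
      _ ≤ (n : ℝ) ^ (1 / ζ) * (M * (n : ℝ) ^ (-((1 - ξ - ε) * c))) := by gcongr
      _ = M * (n : ℝ) ^ (-((1 - ξ - ε) * c - 1 / ζ)) := by
          rw [mul_left_comm, ← Real.rpow_add hn0]
          congr 2
          ring
      _ < M := by
          have : (0 : ℝ) ≤ (n : ℝ) ^ (-(1 - 2 * ξ)) := by positivity
          exact mul_lt_of_lt_one_right hM (by linarith)
  obtain ⟨U, hU, hUP⟩ := exists_mem_notMem_of_card_lt_card hlt
  refine ⟨U, (mem_powersetCard.1 hU).1, (mem_powersetCard.1 hU).2, fun B hBP => ?_⟩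
  by_contra! hlt
  exact hUP (mem_biUnion.2 ⟨B, hBP, mem_filter.2 ⟨hU, hlt.le⟩⟩)
end
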